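/- arXiv:1605.01970 — 12 statements merged into one kernel-verified Lean document; each statement's English description precedes it below -/
import Mathlib

section
/- Let A, B, C, D be n×n complex matrices. Suppose A has a group inverse A# and that the pseudo Schur complement K = D - C·A#·B has a group inverse K#. Let M be the 2n×2n block matrix M = [[A, B],[C, D]]. Then the four range inclusions R(C*) ⊆ R(A*), R(B) ⊆ R(A), R(C) ⊆ R(K), and R(B*) ⊆ R(K*) hold if and only if the block matrix X = [[A# + A#·B·K#·C·A#, -A#·B·K#],[-K#·C·A#, K#]] is the group inverse of M (i.e., M·X·M = M, X·M·X = X, and M·X = X·M). -/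
open Matrix

section BlockProducts

variable {n : ℕ} {A B C Ag K Kg : Matrix (Fin n) (Fin n) ℂ}

/-- The product of a block matrix with its candidate group inverse. -/
lemma fromBlocks_mul_candidate :
    fromBlocks A B C (K + C * Ag * B) *
        fromBlocks (Ag + Ag * B * Kg * C * Ag) (-(Ag * B * Kg)) (-(Kg * C * Ag)) Kg =
      fromBlocks (A * Ag - (B - A * Ag * B) * Kg * C * Ag) ((B - A * Ag * B) * Kg)
        ((C - K * Kg * C) * Ag) (K * Kg) := by
  rw [fromBlocks_multiply]
  congr 1 <;> noncomm_ring

/-- The product of the candidate group inverse with the block matrix. -/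
lemma candidate_mul_fromBlocks :
    fromBlocks (Ag + Ag * B * Kg * C * Ag) (-(Ag * B * Kg)) (-(Kg * C * Ag)) Kg *
        fromBlocks A B C (K + C * Ag * B) =
      fromBlocks (Ag * A - Ag * B * Kg * (C - C * (Ag * A))) (Ag * (B - B * (Kg * K)))
        (Kg * (C - C * (Ag * A))) (Kg * K) := by
  rw [fromBlocks_multiply]
  congr 1 <;> noncomm_ring

end BlockProducts

/-- Theorem 1 (Bisht–Sivakumar): group inverse of a block matrix via the pseudo Schur
complement `K = D - C·A#·B`.  The four range inclusions hold iff the indicated block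
matrix is the group inverse of `M = [[A,B],[C,D]]`. -/
theorem pseudo_ppt_group_inverse_iff {n : ℕ} (A B C D Ag Kg : Matrix (Fin n) (Fin n) ℂ)
    (hAg : A * Ag * A = A ∧ Ag * A * Ag = Ag ∧ A * Ag = Ag * A)
    (K : Matrix (Fin n) (Fin n) ℂ) (hK : K = D - C * Ag * B)
    (hKg : K * Kg * K = K ∧ Kg * K * Kg = Kg ∧ K * Kg = Kg * K) :
    ((∃ W, C = W * A) ∧ (∃ Z, B = A * Z) ∧ (∃ Z, C = K * Z) ∧ (∃ W, B = W * K)) ↔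
      (fromBlocks A B C D *
          fromBlocks (Ag + Ag * B * Kg * C * Ag) (-(Ag * B * Kg)) (-(Kg * C * Ag)) Kg *
          fromBlocks A B C D = fromBlocks A B C D ∧
        fromBlocks (Ag + Ag * B * Kg * C * Ag) (-(Ag * B * Kg)) (-(Kg * C * Ag)) Kg *
          fromBlocks A B C D *
          fromBlocks (Ag + Ag * B * Kg * C * Ag) (-(Ag * B * Kg)) (-(Kg * C * Ag)) Kg =
          fromBlocks (Ag + Ag * B * Kg * C * Ag) (-(Ag * B * Kg)) (-(Kg * C * Ag)) Kg ∧
        fromBlocks A B C D *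
          fromBlocks (Ag + Ag * B * Kg * C * Ag) (-(Ag * B * Kg)) (-(Kg * C * Ag)) Kg =
          fromBlocks (Ag + Ag * B * Kg * C * Ag) (-(Ag * B * Kg)) (-(Kg * C * Ag)) Kg *
            fromBlocks A B C D) := by
  obtain ⟨hA, hA', hAc⟩ := hAg
  obtain ⟨hKK, hK', hKc⟩ := hKg
  obtain rfl : D = K + C * Ag * B := by rw [hK]; abel
  rw [fromBlocks_mul_candidate, candidate_mul_fromBlocks, ← hAc, ← hKc]
  have hPAg : A * Ag * Ag = Ag := by rw [hAc, hA']
  have hQKg : K * Kg * Kg = Kg := by rw [hKc, hK']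
  constructor
  · rintro ⟨⟨W, hW⟩, ⟨Z, hZ⟩, ⟨Y, hY⟩, ⟨V, hV⟩⟩
    have hCP : C * (A * Ag) = C := by
      rw [hW, Matrix.mul_assoc W, hAc, ← Matrix.mul_assoc A, hA]
    have hPB : A * Ag * B = B := by
      rw [hZ, ← Matrix.mul_assoc, hA]
    have hQC : K * Kg * C = C := by
      rw [hY, ← Matrix.mul_assoc, hKK]
    have hBQ : B * (K * Kg) = B := by
      rw [hV, Matrix.mul_assoc V, hKc, ← Matrix.mul_assoc K, hKK]
    simp only [hCP, hPB, hQC, hBQ, sub_self, Matrix.zero_mul, Matrix.mul_zero, sub_zero,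
      fromBlocks_multiply, zero_add, add_zero, and_true, Matrix.mul_add, Matrix.mul_neg,
      ← Matrix.mul_assoc, hA, hKK, hPAg, hQKg, neg_zero]
  · rintro ⟨hM, -, hcomm⟩
    obtain ⟨-, h12, h21, -⟩ := fromBlocks_inj.mp hcomm
    have hB : (B - A * Ag * B) * Kg = 0 := by
      have h := congrArg (A * Ag * ·) h12
      have h0 : A * Ag * ((B - A * Ag * B) * Kg) = 0 := by
        rw [← Matrix.mul_assoc, Matrix.mul_sub, ← Matrix.mul_assoc (A * Ag),
          ← Matrix.mul_assoc (A * Ag), hA, sub_self, Matrix.zero_mul]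
      simp only [h0, ← Matrix.mul_assoc (A * Ag), hPAg] at h
      rw [h12, ← h]
    have hC : (C - K * Kg * C) * Ag = 0 := by
      have h := congrArg (K * Kg * ·) h21
      have h0 : K * Kg * ((C - K * Kg * C) * Ag) = 0 := by
        rw [← Matrix.mul_assoc, Matrix.mul_sub, ← Matrix.mul_assoc (K * Kg),
          ← Matrix.mul_assoc (K * Kg), hKK, sub_self, Matrix.zero_mul]
      simp only [h0, ← Matrix.mul_assoc (K * Kg), hQKg] at h
      rw [h21, ← h]
    have hMX : fromBlocks A B C (K + C * Ag * B) *
        fromBlocks (Ag + Ag * B * Kg * C * Ag) (-(Ag * B * Kg)) (-(Kg * C * Ag)) Kg =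
        fromBlocks (A * Ag) 0 0 (K * Kg) := by
      rw [fromBlocks_mul_candidate, hB, hC]
      simp
    have hXM : fromBlocks (Ag + Ag * B * Kg * C * Ag) (-(Ag * B * Kg)) (-(Kg * C * Ag)) Kg *
        fromBlocks A B C (K + C * Ag * B) = fromBlocks (A * Ag) 0 0 (K * Kg) := by
      rw [← hMX, fromBlocks_mul_candidate, hcomm, candidate_mul_fromBlocks, ← hAc, ← hKc]
    rw [← fromBlocks_mul_candidate] at hM
    have hM' := hM
    rw [hMX, fromBlocks_multiply] at hM
    rw [Matrix.mul_assoc, hXM, fromBlocks_multiply] at hM'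
    obtain ⟨-, hPB, hQC, -⟩ := fromBlocks_inj.mp hM
    obtain ⟨-, hBQ, hCP, -⟩ := fromBlocks_inj.mp hM'
    simp only [Matrix.zero_mul, Matrix.mul_zero, add_zero, zero_add] at hPB hQC hBQ hCP
    refine ⟨⟨C * Ag, ?_⟩, ⟨Ag * B, ?_⟩, ⟨Kg * C, ?_⟩, ⟨B * Kg, ?_⟩⟩
    · rw [Matrix.mul_assoc, ← hAc, hCP]
    · rw [← Matrix.mul_assoc, hPB]
    · rw [← Matrix.mul_assoc, hQC]
    · rw [Matrix.mul_assoc, ← hKc, hBQ]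
end

section
/- Let A, B, C, D be n×n complex matrices. Suppose A has a group inverse A# and that K = D - C·A#·B has a group inverse K#. Assume the range inclusions R(C*) ⊆ R(A*), R(B) ⊆ R(A), R(C) ⊆ R(K), and R(B*) ⊆ R(K*). Then the block matrix M = [[A, B],[C, D]] has a group inverse, given by M# = [[A# + A#·B·K#·C·A#, -A#·B·K#],[-K#·C·A#, K#]]. -/
open Matrix

/-- The product of the block matrix with Schur complement `K` and the candidate inverse built from
`Ag` and `Kg` is block diagonal. -/
theorem fromBlocks_mul_schur_inverse {R m n : Type*} [Ring R] [Fintype m] [Fintype n]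
    {A Ag : Matrix m m R} {B : Matrix m n R} {C : Matrix n m R} {K Kg : Matrix n n R}
    (hB : A * Ag * B = B) (hC : K * Kg * C = C) :
    fromBlocks A B C (K + C * Ag * B) *
        fromBlocks (Ag + Ag * B * Kg * C * Ag) (-(Ag * B * Kg)) (-(Kg * C * Ag)) Kg =
      fromBlocks (A * Ag) 0 0 (K * Kg) := by
  have hB' (Y : Matrix n m R) : A * (Ag * (B * Y)) = B * Y := by
    rw [← Matrix.mul_assoc, ← Matrix.mul_assoc, hB]
  have hB'' (Y : Matrix n n R) : A * (Ag * (B * Y)) = B * Y := by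
    rw [← Matrix.mul_assoc, ← Matrix.mul_assoc, hB]
  have hC' (Y : Matrix m m R) : K * (Kg * (C * Y)) = C * Y := by
    rw [← Matrix.mul_assoc, ← Matrix.mul_assoc, hC]
  rw [fromBlocks_multiply, fromBlocks_inj]
  refine ⟨?_, ?_, ?_, ?_⟩ <;>
    simp only [Matrix.mul_add, Matrix.add_mul, Matrix.mul_neg, Matrix.mul_assoc, hB', hB'', hC'] <;>
    abel

/-- The product of the candidate inverse built from `Ag` and `Kg` and the block matrix with Schur
complement `K` is block diagonal. -/
theorem schur_inverse_mul_fromBlocks {R m n : Type*} [Ring R] [Fintype m] [Fintype n]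
    {A Ag : Matrix m m R} {B : Matrix m n R} {C : Matrix n m R} {K Kg : Matrix n n R}
    (hB : B * Kg * K = B) (hC : C * Ag * A = C) :
    fromBlocks (Ag + Ag * B * Kg * C * Ag) (-(Ag * B * Kg)) (-(Kg * C * Ag)) Kg *
        fromBlocks A B C (K + C * Ag * B) =
      fromBlocks (Ag * A) 0 0 (Kg * K) := by
  rw [Matrix.mul_assoc] at hB hC
  rw [fromBlocks_multiply, fromBlocks_inj]
  refine ⟨?_, ?_, ?_, ?_⟩ <;>
    simp only [Matrix.mul_add, Matrix.add_mul, Matrix.neg_mul, Matrix.mul_assoc, hB, hC] <;>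
    abel

/-- Sufficiency part of Theorem 1: under the four range inclusions, the block matrix
`M = [[A,B],[C,D]]` has a group inverse, given by the indicated block formula. -/
theorem pseudo_ppt_group_inverse_formula {n : ℕ} (A B C D Ag Kg : Matrix (Fin n) (Fin n) ℂ)
    (hAg : A * Ag * A = A ∧ Ag * A * Ag = Ag ∧ A * Ag = Ag * A)
    (K : Matrix (Fin n) (Fin n) ℂ) (hK : K = D - C * Ag * B)
    (hKg : K * Kg * K = K ∧ Kg * K * Kg = Kg ∧ K * Kg = Kg * K)
    (hC : ∃ W, C = W * A) (hB : ∃ Z, B = A * Z)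
    (hCK : ∃ Z, C = K * Z) (hBK : ∃ W, B = W * K)
    (M X : Matrix (Fin n ⊕ Fin n) (Fin n ⊕ Fin n) ℂ)
    (hM : M = fromBlocks A B C D)
    (hX : X = fromBlocks (Ag + Ag * B * Kg * C * Ag) (-(Ag * B * Kg)) (-(Kg * C * Ag)) Kg) :
    M * X * M = M ∧ X * M * X = X ∧ M * X = X * M := by
  obtain ⟨hA₁, hA₂, hA₃⟩ := hAg
  obtain ⟨hK₁, hK₂, hK₃⟩ := hKg
  have hAB : A * Ag * B = B := by
    obtain ⟨Z, rfl⟩ := hB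
    rw [← Matrix.mul_assoc, hA₁]
  have hCA : C * Ag * A = C := by
    obtain ⟨W, rfl⟩ := hC
    rw [Matrix.mul_assoc, Matrix.mul_assoc, ← Matrix.mul_assoc A, hA₁]
  have hKC : K * Kg * C = C := by
    obtain ⟨Z, hZ⟩ := hCK
    rw [hZ, ← Matrix.mul_assoc, hK₁]
  have hBK' : B * Kg * K = B := by
    obtain ⟨W, hW⟩ := hBK
    rw [hW, Matrix.mul_assoc, Matrix.mul_assoc, ← Matrix.mul_assoc K, hK₁]
  obtain rfl : D = K + C * Ag * B := by rw [hK, sub_add_cancel]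
  have hMX : M * X = fromBlocks (A * Ag) 0 0 (K * Kg) := by
    rw [hM, hX, fromBlocks_mul_schur_inverse hAB hKC]
  have hXM : X * M = fromBlocks (Ag * A) 0 0 (Kg * K) := by
    rw [hM, hX, schur_inverse_mul_fromBlocks hBK' hCA]
  refine ⟨?_, ?_, by rw [hMX, hXM, hA₃, hK₃]⟩
  · rw [hMX, hM, fromBlocks_multiply]
    simp only [Matrix.zero_mul, add_zero, zero_add, Matrix.mul_add, hA₁, hAB, hKC, hK₁,
      ← Matrix.mul_assoc]
  · rw [hXM, hX, fromBlocks_multiply]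
    simp only [Matrix.zero_mul, add_zero, zero_add, Matrix.mul_add, Matrix.mul_neg, neg_zero, hA₂, hK₂,
      ← Matrix.mul_assoc]
end

section
/- Let A, B, C, D be n×n complex matrices. Suppose A has a group inverse A# and that K = D - C·A#·B has a group inverse K#. If the block matrix X = [[A# + A#·B·K#·C·A#, -A#·B·K#],[-K#·C·A#, K#]] is the group inverse of M = [[A, B],[C, D]] (i.e., M·X·M = M, X·M·X = X, and M·X = X·M), then R(C*) ⊆ R(A*), R(B) ⊆ R(A), R(C) ⊆ R(K), and R(B*) ⊆ R(K*). -/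
open Matrix

theorem mul_eq_zero_of_eq_sub_mul {R : Type*} [Ring R] {k g x u : R} (hg : g * k * g = g)
    (hkg : k * g = g * k) (h : x * g = u - u * (g * k)) : x * g = 0 := by
  have hx : x * g * (g * k) = x * g := by rw [← hkg, mul_assoc, ← mul_assoc g, hg]
  rw [← hx, h, sub_mul, mul_assoc u, ← mul_assoc (g * k), hg, sub_self]

theorem mul_eq_zero_of_eq_sub_mul' {R : Type*} [Ring R] {k g x u : R} (hg : g * k * g = g)
    (hkg : k * g = g * k) (h : g * x = u - k * g * u) : g * x = 0 := by
  have hx : k * g * (g * x) = g * x := by rw [hkg, ← mul_assoc, hg]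
  rw [← hx, h, hkg, mul_sub, ← mul_assoc (g * k) (g * k), ← mul_assoc (g * k) g, hg, sub_self]

/-- Necessity part of Theorem 1: if the indicated block matrix is the group inverse of
`M = [[A,B],[C,D]]`, then the four range inclusions hold. -/
theorem range_inclusions_of_group_inverse {n : ℕ} (A B C D Ag Kg : Matrix (Fin n) (Fin n) ℂ)
    (hAg : A * Ag * A = A ∧ Ag * A * Ag = Ag ∧ A * Ag = Ag * A)
    (K : Matrix (Fin n) (Fin n) ℂ) (hK : K = D - C * Ag * B)
    (hKg : K * Kg * K = K ∧ Kg * K * Kg = Kg ∧ K * Kg = Kg * K)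
    (M X : Matrix (Fin n ⊕ Fin n) (Fin n ⊕ Fin n) ℂ)
    (hM : M = fromBlocks A B C D)
    (hX : X = fromBlocks (Ag + Ag * B * Kg * C * Ag) (-(Ag * B * Kg)) (-(Kg * C * Ag)) Kg)
    (h1 : M * X * M = M) (h2 : X * M * X = X) (h3 : M * X = X * M) :
    (∃ W, C = W * A) ∧ (∃ Z, B = A * Z) ∧ (∃ Z, C = K * Z) ∧ (∃ W, B = W * K) := by
  obtain ⟨hA1, hA2, hA3⟩ := hAg
  obtain ⟨hK1, hK2, hK3⟩ := hKg
  have hD : D = K + C * Ag * B := by rw [hK]; abel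
  have hMX : M * X = fromBlocks (A * Ag - (B * Kg - A * Ag * B * Kg) * C * Ag)
      (B * Kg - A * Ag * B * Kg) (C * Ag - K * Kg * C * Ag) (K * Kg) := by
    rw [hM, hX, hD, fromBlocks_multiply]
    congr 1 <;> noncomm_ring
  have hXM : X * M = fromBlocks (Ag * A - Ag * B * (Kg * C - Kg * C * Ag * A))
      (Ag * B - Ag * B * Kg * K) (Kg * C - Kg * C * Ag * A) (Kg * K) := by
    rw [hM, hX, hD, fromBlocks_multiply]
    congr 1 <;> noncomm_ring
  obtain ⟨-, h12, h21, -⟩ := fromBlocks_inj.mp (hMX.symm.trans (h3.trans hXM))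
  have hB : B * Kg - A * Ag * B * Kg = 0 := by
    rw [← sub_mul] at h12 ⊢
    exact mul_eq_zero_of_eq_sub_mul hK2 hK3 (h12.trans (by rw [mul_assoc (Ag * B)]))
  have hC : C * Ag - K * Kg * C * Ag = 0 := by
    have hr : Kg * C - Kg * C * Ag * A = Kg * (C - C * Ag * A) := by
      simp only [mul_sub, mul_assoc]
    rw [h21, hr]
    exact mul_eq_zero_of_eq_sub_mul' hK2 hK3 (u := C * Ag)
      (by rw [← hr, ← h21, mul_assoc (K * Kg)])
  have hdiag : M * X = fromBlocks (A * Ag) 0 0 (K * Kg) := by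
    rw [hMX, hB, hC]; simp
  have hright : M * (M * X) = M := by rw [h3, ← mul_assoc, h1]
  rw [hdiag, hM, fromBlocks_multiply] at h1 hright
  obtain ⟨-, hPB, hQC, -⟩ := fromBlocks_inj.mp h1
  obtain ⟨-, hBQ, hCP, -⟩ := fromBlocks_inj.mp hright
  simp only [zero_mul, mul_zero, add_zero, zero_add] at hPB hQC hBQ hCP
  refine ⟨⟨C * Ag, ?_⟩, ⟨Ag * B, ?_⟩, ⟨Kg * C, ?_⟩, ⟨B * Kg, ?_⟩⟩
  · rw [mul_assoc, ← hA3, hCP]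
  · rw [← mul_assoc, hPB]
  · rw [← mul_assoc, hQC]
  · rw [mul_assoc, ← hK3, hBQ]
end

section
/- Let A, B, C, D be n×n complex matrices. Suppose D has a group inverse D# and that the complementary pseudo Schur complement L = A - B·D#·C has a group inverse L#. Let M = [[A, B],[C, D]]. Then the four range inclusions R(B*) ⊆ R(D*), R(C) ⊆ R(D), R(B) ⊆ R(L), and R(C*) ⊆ R(L*) hold if and only if the block matrix [[L#, -L#·B·D#],[-D#·C·L#, D# + D#·C·L#·B·D#]] is the group inverse of M. -/
open Matrix

section Blocks

variable {m R : Type*} [Fintype m] [DecidableEq m] [Ring R]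

/-- The product of `[[L + B·E·C, B], [C, D]]` with the block candidate for its inverse. -/
lemma fromBlocks_mul_pseudo_inverse (B C D E L K : Matrix m m R) :
    fromBlocks (L + B * E * C) B C D *
        fromBlocks K (-(K * B * E)) (-(E * C * K)) (E + E * C * K * B * E) =
      fromBlocks (L * K) ((1 - L * K) * B * E) ((1 - D * E) * C * K)
        (D * E - (1 - D * E) * C * K * B * E) := by
  rw [fromBlocks_multiply]
  congr 1 <;> noncomm_ring

/-- The product of the block candidate for the inverse with `[[L + B·E·C, B], [C, D]]`. -/
lemma pseudo_inverse_mul_fromBlocks (B C D E L K : Matrix m m R) :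
    fromBlocks K (-(K * B * E)) (-(E * C * K)) (E + E * C * K * B * E) *
        fromBlocks (L + B * E * C) B C D =
      fromBlocks (K * L) (K * B * (1 - E * D)) (E * C * (1 - K * L))
        (E * D - E * C * K * B * (1 - E * D)) := by
  rw [fromBlocks_multiply]
  congr 1 <;> noncomm_ring

end Blocks

/-- If `S` is an outer inverse of `T` commuting with `T`, then a right multiple of `S` that is
also a right multiple of `1 - T·S` vanishes. -/
lemma eq_zero_of_one_sub_mul_eq {R : Type*} [Ring R] {T S Y Z : R}
    (hS : S * T * S = S) (hTS : T * S = S * T)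
    (h : (1 - T * S) * Y = S * Z) : S * Z = 0 := by
  have h1 : S * T * (1 - T * S) = 0 := by
    rw [mul_sub, mul_one, hTS, ← mul_assoc, hS, sub_self]
  calc S * Z = S * T * (S * Z) := by rw [← mul_assoc, hS]
    _ = 0 := by rw [← h, ← mul_assoc, h1, zero_mul]

/-- Theorem 2 (Bisht–Sivakumar): group inverse of a block matrix via the complementary
pseudo Schur complement `L = A - B·D#·C`. -/
theorem complementary_pseudo_ppt_group_inverse_iff {n : ℕ}
    (A B C D Dg Lg : Matrix (Fin n) (Fin n) ℂ)
    (hDg : D * Dg * D = D ∧ Dg * D * Dg = Dg ∧ D * Dg = Dg * D)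
    (L : Matrix (Fin n) (Fin n) ℂ) (hL : L = A - B * Dg * C)
    (hLg : L * Lg * L = L ∧ Lg * L * Lg = Lg ∧ L * Lg = Lg * L)
    (M X : Matrix (Fin n ⊕ Fin n) (Fin n ⊕ Fin n) ℂ)
    (hM : M = fromBlocks A B C D)
    (hX : X = fromBlocks Lg (-(Lg * B * Dg)) (-(Dg * C * Lg)) (Dg + Dg * C * Lg * B * Dg)) :
    ((∃ W, B = W * D) ∧ (∃ Z, C = D * Z) ∧ (∃ Z, B = L * Z) ∧ (∃ W, C = W * L)) ↔
      (M * X * M = M ∧ X * M * X = X ∧ M * X = X * M) := by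
  obtain ⟨hD1, hD2, hD3⟩ := hDg
  obtain ⟨hL1, hL2, hL3⟩ := hLg
  obtain rfl : A = L + B * Dg * C := by rw [hL]; abel
  have hMX := fromBlocks_mul_pseudo_inverse B C D Dg L Lg
  have hXM := pseudo_inverse_mul_fromBlocks B C D Dg L Lg
  rw [← hM, ← hX] at hMX hXM
  constructor
  · rintro ⟨⟨W, hW⟩, ⟨Z, hZ⟩, ⟨Y, hY⟩, ⟨V, hV⟩⟩
    have hBP : B * (Dg * D) = B := by rw [hW, mul_assoc, ← mul_assoc D, hD1]
    have hPC : D * Dg * C = C := by rw [hZ, ← mul_assoc, hD1]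
    have hQB : L * Lg * B = B := by rw [hY, ← mul_assoc, hL1]
    have hCQ : C * (Lg * L) = C := by rw [hV, mul_assoc, ← mul_assoc L, hL1]
    simp only [sub_mul, one_mul, hQB, hPC, sub_self, zero_mul, sub_zero] at hMX
    simp only [mul_sub, mul_one, mul_assoc, hBP, hCQ, sub_self, sub_zero] at hXM
    refine ⟨?_, ?_, ?_⟩
    · rw [hMX, hM, fromBlocks_multiply]
      simp only [zero_mul, add_zero, zero_add, mul_add, hQB, hPC, hD1, hL1, ← mul_assoc]
    · rw [hXM, hX, fromBlocks_multiply]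
      simp only [zero_mul, add_zero, zero_add, mul_add, mul_neg, neg_zero, hD2, hL2, ← mul_assoc]
    · rw [hMX, hXM, hL3, hD3]
  · rintro ⟨h1, -, h3⟩
    have hcomm := h3
    rw [hMX, hXM, fromBlocks_inj] at hcomm
    obtain ⟨-, h12, h21, -⟩ := hcomm
    have hB : Lg * (B * (1 - Dg * D)) = 0 :=
      eq_zero_of_one_sub_mul_eq hL2 hL3 (by simpa only [mul_assoc] using h12)
    have hC : Dg * (C * (1 - Lg * L)) = 0 :=
      eq_zero_of_one_sub_mul_eq hD2 hD3 (by simpa only [mul_assoc] using h21)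
    rw [← mul_assoc] at hB hC
    have hXM' : X * M = fromBlocks (Lg * L) 0 0 (Dg * D) := by
      rw [hXM, hB, hC, mul_assoc (Dg * C), mul_assoc (Dg * C), hB, mul_zero, sub_zero]
    have hl : X * M * M = M := by rw [← h3, h1]
    have hr : M * (X * M) = M := by rw [← mul_assoc, h1]
    rw [hXM', hM, fromBlocks_multiply, fromBlocks_inj] at hl hr
    simp only [zero_mul, mul_zero, add_zero, zero_add] at hl hr
    obtain ⟨-, hQB, hPC, -⟩ := hl
    obtain ⟨-, hBP, hCQ, -⟩ := hr
    refine ⟨⟨B * Dg, ?_⟩, ⟨Dg * C, ?_⟩, ⟨Lg * B, ?_⟩, ⟨C * Lg, ?_⟩⟩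
    · rw [mul_assoc, hBP]
    · rw [← mul_assoc, hD3, hPC]
    · rw [← mul_assoc, hL3, hQB]
    · rw [mul_assoc, hCQ]
end

section
/- Let A, B, C, D be n×n complex matrices and suppose A has a group inverse A#. Assume R(B) ⊆ R(A) and R(C*) ⊆ R(A*). Let P = pppt(M,A)# = [[A#, -A#·B],[C·A#, K]] with K = D - C·A#·B be the pseudo principal pivot transform of M = [[A,B],[C,D]] relative to A. Then applying the pseudo principal pivot transform to P relative to its top-left block A# (using that A is the group inverse of A#) recovers M; that is, [[(A#)#, -(A#)#·(-A#·B)],[(C·A#)·(A#)#, K - (C·A#)·(A#)#·(-A#·B)]] = [[A,B],[C,D]]. -/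
open Matrix

/-- Lemma (involution of the pseudo principal pivot transform, part (i)):
applying `pppt` to `P = pppt(M,A)#` relative to its top-left block `A#`
(whose group inverse is `(A#)# = A`) recovers `M`. -/
theorem pppt_involution {n : ℕ} (A B C D Ag : Matrix (Fin n) (Fin n) ℂ)
    (hAg : A * Ag * A = A ∧ Ag * A * Ag = Ag ∧ A * Ag = Ag * A)
    (hB : ∃ Z, B = A * Z) (hC : ∃ W, C = W * A)
    (K : Matrix (Fin n) (Fin n) ℂ) (hK : K = D - C * Ag * B) :
    fromBlocks A (-(A * (-(Ag * B)))) ((C * Ag) * A) (K - (C * Ag) * A * (-(Ag * B))) =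
      fromBlocks A B C D := by
  obtain ⟨hA, -, -⟩ := hAg
  have hAB : A * (Ag * B) = B := by
    obtain ⟨Z, rfl⟩ := hB
    rw [← Matrix.mul_assoc, ← Matrix.mul_assoc, hA]
  have hCA : C * Ag * A = C := by
    obtain ⟨W, rfl⟩ := hC
    rw [Matrix.mul_assoc, Matrix.mul_assoc, ← Matrix.mul_assoc A, hA]
  rw [hCA, Matrix.mul_neg, Matrix.mul_neg, neg_neg, hAB, hK, sub_neg_eq_add,
    ← Matrix.mul_assoc, sub_add_cancel]
end

section
/- Let A, B, C, D be n×n complex matrices and suppose D has a group inverse D#. Assume R(C) ⊆ R(D) and R(B*) ⊆ R(D*). Let Q = cpppt(M,D)# = [[L, B·D#],[-D#·C, D#]] with L = A - B·D#·C be the complementary pseudo principal pivot transform of M = [[A,B],[C,D]] relative to D. Then applying the complementary pseudo principal pivot transform to Q relative to its bottom-right block D# (using that D is the group inverse of D#) recovers M; that is, [[L - (B·D#)·(D#)#·(-D#·C), (B·D#)·(D#)#],[-(D#)#·(-D#·C), (D#)#]] = [[A,B],[C,D]]. -/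
open Matrix

/-- Lemma (involution of the complementary pseudo principal pivot transform, part (ii)):
applying `cpppt` to `Q = cpppt(M,D)#` relative to its bottom-right block `D#`
(whose group inverse is `(D#)# = D`) recovers `M`. -/
theorem cpppt_involution {n : ℕ} (A B C D Dg : Matrix (Fin n) (Fin n) ℂ)
    (hDg : D * Dg * D = D ∧ Dg * D * Dg = Dg ∧ D * Dg = Dg * D)
    (hC : ∃ Z, C = D * Z) (hB : ∃ W, B = W * D)
    (L : Matrix (Fin n) (Fin n) ℂ) (hL : L = A - B * Dg * C) :
    fromBlocks (L - (B * Dg) * D * (-(Dg * C))) ((B * Dg) * D) (-(D * (-(Dg * C)))) D =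
      fromBlocks A B C D := by
  obtain ⟨hD, -, -⟩ := hDg
  have hBD : B * Dg * D = B := by
    obtain ⟨W, rfl⟩ := hB
    rw [Matrix.mul_assoc, Matrix.mul_assoc, ← Matrix.mul_assoc D, hD]
  have hDC : D * (Dg * C) = C := by
    obtain ⟨Z, rfl⟩ := hC
    rw [← Matrix.mul_assoc, ← Matrix.mul_assoc, hD]
  have hA : L - B * Dg * D * (-(Dg * C)) = A := by
    rw [hBD, hL, Matrix.mul_neg, ← Matrix.mul_assoc, sub_neg_eq_add, sub_add_cancel]
  rw [hA, hBD, Matrix.mul_neg, neg_neg, hDC]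
end

section
/- Let A, B, C, D be n×n complex matrices, suppose A has a group inverse A#, and assume R(B) ⊆ R(A) and R(C*) ⊆ R(A*). Set K = D - C·A#·B, M = [[A,B],[C,D]], and P = [[A#, -A#·B],[C·A#, K]]. Then for all vectors x¹, x², y¹, y² ∈ ℂⁿ: A·x¹ + B·x² = A·A#·y¹ and C·x¹ + D·x² = y² hold if and only if A#·y¹ - A#·B·x² = A#·A·x¹ and C·A#·y¹ + K·x² = y² hold. (Equivalently, M·(x¹,x²) = (A·A#·y¹, y²) if and only if P·(y¹,x²) = (A#·A·x¹, y²).) -/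
open Matrix

/-- Lemma (domain–range exchange, part (i)): `M·(x¹,x²) = (A·A#·y¹, y²)` iff
`P·(y¹,x²) = (A#·A·x¹, y²)`, where `P = pppt(M,A)#`. -/
theorem pppt_domain_range_exchange {n : ℕ} (A B C D Ag : Matrix (Fin n) (Fin n) ℂ)
    (hAg : A * Ag * A = A ∧ Ag * A * Ag = Ag ∧ A * Ag = Ag * A)
    (hB : ∃ Z, B = A * Z) (hC : ∃ W, C = W * A)
    (K : Matrix (Fin n) (Fin n) ℂ) (hK : K = D - C * Ag * B)
    (x1 x2 y1 y2 : Fin n → ℂ) :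
    (A.mulVec x1 + B.mulVec x2 = (A * Ag).mulVec y1 ∧
        C.mulVec x1 + D.mulVec x2 = y2) ↔
      (Ag.mulVec y1 - (Ag * B).mulVec x2 = (Ag * A).mulVec x1 ∧
        (C * Ag).mulVec y1 + K.mulVec x2 = y2) := by
  obtain ⟨hA, hAg', -⟩ := hAg
  have hB' : A * (Ag * B) = B := by
    obtain ⟨Z, rfl⟩ := hB
    rw [← Matrix.mul_assoc, ← Matrix.mul_assoc, hA]
  have hC' : C * (Ag * A) = C := by
    obtain ⟨W, rfl⟩ := hC
    rw [Matrix.mul_assoc, ← Matrix.mul_assoc A, hA]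
  have first_iff : A.mulVec x1 + B.mulVec x2 = (A * Ag).mulVec y1 ↔
      Ag.mulVec y1 - (Ag * B).mulVec x2 = (Ag * A).mulVec x1 := by
    constructor
    · intro h
      have h' := congrArg Ag.mulVec h
      rw [mulVec_add, mulVec_mulVec, mulVec_mulVec, mulVec_mulVec, ← Matrix.mul_assoc,
        hAg'] at h'
      rw [← h', add_sub_cancel_right]
    · intro h
      have h' := congrArg A.mulVec h
      rw [mulVec_sub, mulVec_mulVec, mulVec_mulVec, mulVec_mulVec, hB', ← Matrix.mul_assoc,
        hA] at h'
      rw [← h', sub_add_cancel]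
  rw [first_iff]
  refine and_congr_right fun h => ?_
  have h' := congrArg C.mulVec h
  rw [mulVec_sub, mulVec_mulVec, mulVec_mulVec, mulVec_mulVec, hC', ← Matrix.mul_assoc] at h'
  rw [hK, sub_mulVec, ← h', sub_add_eq_add_sub, add_sub_assoc]
end

section
/- Let A, B, C, D be n×n complex matrices, suppose A has a group inverse A# and K = D - C·A#·B has a group inverse K#. Assume R(C*) ⊆ R(A*), R(B) ⊆ R(A), R(C) ⊆ R(K), and R(B*) ⊆ R(K*). Set M = [[A,B],[C,D]] and X = [[A# + A#·B·K#·C·A#, -A#·B·K#],[-K#·C·A#, K#]]. Then X·M = [[A#·A, 0],[0, K#·K]] and M·X = [[A·A#, 0],[0, K·K#]]. -/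
open Matrix

/-- Under the four range inclusions, `X·M = [[A#·A, 0],[0, K#·K]]` and
`M·X = [[A·A#, 0],[0, K·K#]]`. -/
theorem XM_and_MX_block_diagonal {n : ℕ} (A B C D Ag Kg : Matrix (Fin n) (Fin n) ℂ)
    (hAg : A * Ag * A = A ∧ Ag * A * Ag = Ag ∧ A * Ag = Ag * A)
    (K : Matrix (Fin n) (Fin n) ℂ) (hK : K = D - C * Ag * B)
    (hKg : K * Kg * K = K ∧ Kg * K * Kg = Kg ∧ K * Kg = Kg * K)
    (hC : ∃ W, C = W * A) (hB : ∃ Z, B = A * Z)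
    (hCK : ∃ Z, C = K * Z) (hBK : ∃ W, B = W * K)
    (M X : Matrix (Fin n ⊕ Fin n) (Fin n ⊕ Fin n) ℂ)
    (hM : M = fromBlocks A B C D)
    (hX : X = fromBlocks (Ag + Ag * B * Kg * C * Ag) (-(Ag * B * Kg)) (-(Kg * C * Ag)) Kg) :
    X * M = fromBlocks (Ag * A) 0 0 (Kg * K) ∧
      M * X = fromBlocks (A * Ag) 0 0 (K * Kg) := by
  obtain ⟨hA, -, -⟩ := hAg
  obtain ⟨hKK, -, -⟩ := hKg
  have hCA : C * Ag * A = C := by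
    obtain ⟨W, rfl⟩ := hC
    rw [mul_assoc, mul_assoc, ← mul_assoc A, hA]
  have hAB : A * Ag * B = B := by
    obtain ⟨Z, rfl⟩ := hB
    rw [← mul_assoc, hA]
  have hKC : K * Kg * C = C := by
    obtain ⟨Z, hZ⟩ := hCK
    rw [hZ, ← mul_assoc, hKK]
  have hBKK : B * Kg * K = B := by
    obtain ⟨W, hW⟩ := hBK
    rw [hW, mul_assoc, mul_assoc, ← mul_assoc K, hKK]
  have hD : D = K + C * Ag * B := by rw [hK, sub_add_cancel]
  clear hK
  subst hM hX hD
  rw [mul_assoc] at hCA hAB hKC hBKK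
  have hAB' (Y : Matrix (Fin n) (Fin n) ℂ) : A * (Ag * (B * Y)) = B * Y := by
    rw [← mul_assoc Ag, ← mul_assoc A, hAB]
  have hKC' (Y : Matrix (Fin n) (Fin n) ℂ) : K * (Kg * (C * Y)) = C * Y := by
    rw [← mul_assoc Kg, ← mul_assoc K, hKC]
  constructor <;> rw [fromBlocks_multiply] <;> congr 1 <;>
    simp only [mul_assoc, add_mul, mul_add, neg_mul, mul_neg, hCA, hBKK, hAB', hKC'] <;>
    abel
end

section
/- Let A, B, C, D be n×n complex matrices, suppose A has a group inverse A# and K = D - C·A#·B has a group inverse K#. Suppose the block matrix X = [[A# + A#·B·K#·C·A#, -A#·B·K#],[-K#·C·A#, K#]] satisfies M·X·M = M where M = [[A,B],[C,D]]. Then the following three identities hold: (I - A·A#)·B·K#·C·(I - A#·A) = 0, (I - A·A#)·B·(I - K#·K) = 0, and (I - K·K#)·C·(I - A#·A) = 0. -/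
open Matrix

/-- If `M·X·M = M` for the candidate group inverse `X`, then three rank-type
identities hold. -/
theorem identities_of_MXM_eq_M {n : ℕ} (A B C D Ag Kg : Matrix (Fin n) (Fin n) ℂ)
    (hAg : A * Ag * A = A ∧ Ag * A * Ag = Ag ∧ A * Ag = Ag * A)
    (K : Matrix (Fin n) (Fin n) ℂ) (hK : K = D - C * Ag * B)
    (hKg : K * Kg * K = K ∧ Kg * K * Kg = Kg ∧ K * Kg = Kg * K)
    (M X : Matrix (Fin n ⊕ Fin n) (Fin n ⊕ Fin n) ℂ)
    (hM : M = fromBlocks A B C D)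
    (hX : X = fromBlocks (Ag + Ag * B * Kg * C * Ag) (-(Ag * B * Kg)) (-(Kg * C * Ag)) Kg)
    (h : M * X * M = M) :
    (1 - A * Ag) * B * Kg * C * (1 - Ag * A) = 0 ∧
      (1 - A * Ag) * B * (1 - Kg * K) = 0 ∧
      (1 - K * Kg) * C * (1 - Ag * A) = 0 := by
  obtain rfl : D = K + C * Ag * B := by rw [hK]; abel
  rw [hX, hM, fromBlocks_multiply, fromBlocks_multiply, fromBlocks_inj] at h
  obtain ⟨h₁₁, h₁₂, h₂₁, -⟩ := h
  refine ⟨?_, ?_, ?_⟩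
  · rw [← sub_eq_zero.mpr (h₁₁.trans hAg.1.symm)]
    noncomm_ring
  · rw [← sub_eq_zero.mpr h₁₂.symm]
    noncomm_ring
  · rw [← sub_eq_zero.mpr h₂₁.symm]
    noncomm_ring
end

section
/- Let A, B, C, D be n×n complex matrices, suppose A has a group inverse A# and K = D - C·A#·B has a group inverse K#. Suppose the block matrix X = [[A# + A#·B·K#·C·A#, -A#·B·K#],[-K#·C·A#, K#]] satisfies M·X = X·M where M = [[A,B],[C,D]]. Then K#·C·(I - A#·A) = (I - K·K#)·C·A# and (I - A·A#)·B·K# = A#·B·(I - K·K#). -/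
open Matrix

/-- If `M·X = X·M` for the candidate group inverse `X`, then two exchange
identities hold. -/
theorem identities_of_MX_eq_XM {n : ℕ} (A B C D Ag Kg : Matrix (Fin n) (Fin n) ℂ)
    (hAg : A * Ag * A = A ∧ Ag * A * Ag = Ag ∧ A * Ag = Ag * A)
    (K : Matrix (Fin n) (Fin n) ℂ) (hK : K = D - C * Ag * B)
    (hKg : K * Kg * K = K ∧ Kg * K * Kg = Kg ∧ K * Kg = Kg * K)
    (M X : Matrix (Fin n ⊕ Fin n) (Fin n ⊕ Fin n) ℂ)
    (hM : M = fromBlocks A B C D)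
    (hX : X = fromBlocks (Ag + Ag * B * Kg * C * Ag) (-(Ag * B * Kg)) (-(Kg * C * Ag)) Kg)
    (h : M * X = X * M) :
    Kg * C * (1 - Ag * A) = (1 - K * Kg) * C * Ag ∧
      (1 - A * Ag) * B * Kg = Ag * B * (1 - K * Kg) := by
  obtain ⟨-, -, hKcomm⟩ := hKg
  obtain rfl : D = K + C * Ag * B := by rw [hK, sub_add_cancel]
  rw [hM, hX, fromBlocks_multiply, fromBlocks_multiply, fromBlocks_inj] at h
  obtain ⟨-, h₁₂, h₂₁, -⟩ := h
  constructor
  · calc Kg * C * (1 - Ag * A) = -(Kg * C * Ag) * A + Kg * C := by noncomm_ring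
      _ = C * (Ag + Ag * B * Kg * C * Ag) + (K + C * Ag * B) * -(Kg * C * Ag) := h₂₁.symm
      _ = (1 - K * Kg) * C * Ag := by noncomm_ring
  · calc (1 - A * Ag) * B * Kg = A * -(Ag * B * Kg) + B * Kg := by noncomm_ring
      _ = (Ag + Ag * B * Kg * C * Ag) * B + -(Ag * B * Kg) * (K + C * Ag * B) := h₁₂
      _ = Ag * B * (1 - Kg * K) := by noncomm_ring
      _ = Ag * B * (1 - K * Kg) := by rw [hKcomm]
end

section
/- Let A, B, C, D be n×n complex matrices, suppose A has a group inverse A# and K = D - C·A#·B has a group inverse K#. If (I - K·K#)·C·(I - A#·A) = 0 and K#·C·(I - A#·A) = (I - K·K#)·C·A#, then C·A#·A = C (so R(C*) ⊆ R(A*)) and K·K#·C = C (so R(C) ⊆ R(K)). -/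
open Matrix

/-- From `(I - K·K#)·C·(I - A#·A) = 0` and `K#·C·(I - A#·A) = (I - K·K#)·C·A#` one deduces
`C·A#·A = C` (so `R(C*) ⊆ R(A*)`) and `K·K#·C = C` (so `R(C) ⊆ R(K)`). -/
theorem C_range_inclusions_of_identities {n : ℕ} (A B C D Ag Kg : Matrix (Fin n) (Fin n) ℂ)
    (hAg : A * Ag * A = A ∧ Ag * A * Ag = Ag ∧ A * Ag = Ag * A)
    (K : Matrix (Fin n) (Fin n) ℂ) (hK : K = D - C * Ag * B)
    (hKg : K * Kg * K = K ∧ Kg * K * Kg = Kg ∧ K * Kg = Kg * K)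
    (h1 : (1 - K * Kg) * C * (1 - Ag * A) = 0)
    (h2 : Kg * C * (1 - Ag * A) = (1 - K * Kg) * C * Ag) :
    C * Ag * A = C ∧ K * Kg * C = C := by
  obtain ⟨hKKgK, hKgKKg, hKcomm⟩ := hKg
  have hKKgKg : K * Kg * Kg = Kg := by rw [hKcomm, hKgKKg]
  have hproj : K * Kg * (1 - K * Kg) = 0 := by
    rw [mul_sub, mul_one, ← mul_assoc, hKKgK, sub_self]
  have hleft : Kg * C * (1 - Ag * A) = 0 := by
    calc Kg * C * (1 - Ag * A) = K * Kg * Kg * C * (1 - Ag * A) := by rw [hKKgKg]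
      _ = K * Kg * (Kg * C * (1 - Ag * A)) := by simp only [mul_assoc]
      _ = K * Kg * (1 - K * Kg) * C * Ag := by rw [h2]; simp only [mul_assoc]
      _ = 0 := by rw [hproj, zero_mul, zero_mul]
  have hright : (1 - K * Kg) * C * Ag = 0 := h2 ▸ hleft
  constructor
  · refine (sub_eq_zero.mp ?_).symm
    calc C - C * Ag * A
        = (1 - K * Kg) * C * (1 - Ag * A) + K * (Kg * C * (1 - Ag * A)) := by noncomm_ring
      _ = 0 := by rw [h1, hleft, mul_zero, add_zero]
  · refine (sub_eq_zero.mp ?_).symm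
    calc C - K * Kg * C
        = (1 - K * Kg) * C * (1 - Ag * A) + (1 - K * Kg) * C * Ag * A := by noncomm_ring
      _ = 0 := by rw [h1, hright, zero_mul, add_zero]
end

section
/- Let A, B, C, D be n×n complex matrices, suppose A has a group inverse A# and K = D - C·A#·B has a group inverse K#. If (I - A·A#)·B·(I - K#·K) = 0 and (I - A·A#)·B·K# = A#·B·(I - K·K#), then A·A#·B = B (so R(B) ⊆ R(A)) and B·K#·K = B (so R(B*) ⊆ R(K*)). -/
open Matrix

/-- From `(I - A·A#)·B·(I - K#·K) = 0` and `(I - A·A#)·B·K# = A#·B·(I - K·K#)` one deduces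
`A·A#·B = B` (so `R(B) ⊆ R(A)`) and `B·K#·K = B` (so `R(B*) ⊆ R(K*)`). -/
theorem B_range_inclusions_of_identities {n : ℕ} (A B C D Ag Kg : Matrix (Fin n) (Fin n) ℂ)
    (hAg : A * Ag * A = A ∧ Ag * A * Ag = Ag ∧ A * Ag = Ag * A)
    (K : Matrix (Fin n) (Fin n) ℂ) (hK : K = D - C * Ag * B)
    (hKg : K * Kg * K = K ∧ Kg * K * Kg = Kg ∧ K * Kg = Kg * K)
    (h1 : (1 - A * Ag) * B * (1 - Kg * K) = 0)
    (h2 : (1 - A * Ag) * B * Kg = Ag * B * (1 - K * Kg)) :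
    A * Ag * B = B ∧ B * Kg * K = B := by
  obtain ⟨hA, -, hAc⟩ := hAg
  obtain ⟨-, -, hKc⟩ := hKg
  have hA0 : A * (1 - A * Ag) = 0 := by
    rw [mul_sub, mul_one, hAc, ← mul_assoc, hA, sub_self]
  have hPB : A * Ag * B * (1 - Kg * K) = 0 := by
    calc A * Ag * B * (1 - Kg * K) = A * (Ag * B * (1 - K * Kg)) := by
          rw [hKc]; simp only [mul_assoc]
      _ = A * (1 - A * Ag) * B * Kg := by rw [← h2]; simp only [mul_assoc]
      _ = 0 := by rw [hA0, zero_mul, zero_mul]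
  have hB : B * (1 - Kg * K) = 0 := by
    calc B * (1 - Kg * K)
        = (1 - A * Ag) * B * (1 - Kg * K) + A * Ag * B * (1 - Kg * K) := by noncomm_ring
      _ = 0 := by rw [h1, hPB, add_zero]
  have hBK : B * Kg * K = B := by
    rw [mul_sub, mul_one, sub_eq_zero] at hB
    rw [mul_assoc, ← hB]
  refine ⟨?_, hBK⟩
  have hBKg : (1 - A * Ag) * B * Kg = 0 := by
    rw [h2, hKc, mul_assoc, hB, mul_zero]
  have hPB' : (1 - A * Ag) * B = 0 := by
    calc (1 - A * Ag) * B = (1 - A * Ag) * (B * Kg * K) := by rw [hBK]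
      _ = (1 - A * Ag) * B * Kg * K := by simp only [mul_assoc]
      _ = 0 := by rw [hBKg, zero_mul]
  rw [sub_mul, one_mul, sub_eq_zero] at hPB'
  exact hPB'.symm
end
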